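/- If Q is a smooth conic in the complex projective plane ℙ², then the fundamental group π₁(ℙ² ∖ Q) is isomorphic to ℤ/2ℤ. -/

import Mathlib

open MvPolynomial

noncomputable section

/-- The complex projective plane, with the quotient topology. -/
instance : TopologicalSpace (Projectivization ℂ (Fin 3 → ℂ)) :=
  @instTopologicalSpaceQuotient _ (projectivizationSetoid ℂ (Fin 3 → ℂ)) _

abbrev P2 : Type := Projectivization ℂ (Fin 3 → ℂ)

/-- The gradient of a polynomial in three variables. -/
def gradP (P : MvPolynomial (Fin 3) ℂ) (v : Fin 3 → ℂ) : Fin 3 → ℂ :=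
  fun i => eval v (pderiv i P)

/-- The zero locus in `ℙ²` of a (homogeneous) polynomial in three variables. -/
def zeroLocusP2 (P : MvPolynomial (Fin 3) ℂ) : Set P2 :=
  {x | eval x.rep P = 0}

/-- A smooth conic: the zero locus of a homogeneous polynomial of degree 2 whose
gradient vanishes only at the origin. -/
def IsSmoothConic (Q : Set P2) : Prop :=
  ∃ P : MvPolynomial (Fin 3) ℂ, P.IsHomogeneous 2 ∧
    (∀ v : Fin 3 → ℂ, v ≠ 0 → gradP P v ≠ 0) ∧ Q = zeroLocusP2 P

theorem IsSimplyConnected.homotopic_of_forall_mem {X : Type*} [TopologicalSpace X] {s : Set X}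
    (hs : IsSimplyConnected s) {x y : X} (p q : Path x y) (hp : ∀ t, p t ∈ s)
    (hq : ∀ t, q t ∈ s) : p.Homotopic q := by
  have := hs.simplyConnectedSpace
  have hx : x ∈ s := by simpa using hp 0
  have hy : y ∈ s := by simpa using hp 1
  let p' : Path (⟨x, hx⟩ : s) ⟨y, hy⟩ :=
    { toFun t := ⟨p t, hp t⟩, source' := by simp, target' := by simp }
  let q' : Path (⟨x, hx⟩ : s) ⟨y, hy⟩ :=
    { toFun t := ⟨q t, hq t⟩, source' := by simp, target' := by simp }
  exact (SimplyConnectedSpace.paths_homotopic p' q').map ⟨Subtype.val, continuous_subtype_val⟩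

/-- If a path stays in a union of open simply connected sets with path connected pairwise
intersections, all of which contain `b`, then its class is determined by its endpoints. -/
theorem Path.Homotopic.Quotient.mk_trans_eq_of_isOpen_cover {X ι : Type*} [TopologicalSpace X]
    {c : ι → Set X} (hc : ∀ i, IsOpen (c i)) (hsc : ∀ i, IsSimplyConnected (c i))
    (hpc : ∀ i j, IsPathConnected (c i ∩ c j)) (hcov : ⋃ i, c i = Set.univ) {b : X}
    (hb : ∀ i, b ∈ c i) {x y : X} (γ : Path x y) {i j : ι} (δ : Path x b) (ε : Path y b)
    (hδ : ∀ t, δ t ∈ c i) (hε : ∀ t, ε t ∈ c j) :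
    Path.Homotopic.Quotient.mk (γ.trans ε) = Path.Homotopic.Quotient.mk δ := by
  obtain ⟨t, ht0, htm, ⟨N, hN⟩, hsub⟩ := exists_monotone_Icc_subset_open_cover_unitInterval
    (c := fun i => γ ⁻¹' c i) (fun i => (hc i).preimage γ.continuous)
    (by rw [← Set.preimage_iUnion, hcov]; simp)
  have key : ∀ n, ∀ (i j : ι) (δ : Path (γ (t 0)) b) (ε : Path (γ (t n)) b),
      (∀ s, δ s ∈ c i) → (∀ s, ε s ∈ c j) →
      Path.Homotopic.Quotient.mk ((γ.subpath (t 0) (t n)).trans ε) =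
        Path.Homotopic.Quotient.mk δ := by
    intro n
    induction n with
    | zero =>
      intro i j δ ε hδ hε
      obtain ⟨ζ, hζ⟩ := (hpc i j).joinedIn (γ (t 0))
        ⟨by simpa using hδ 0, by simpa using hε 0⟩ b ⟨hb i, hb j⟩
      rw [Path.subpath_self, Path.Homotopic.Quotient.mk_trans, Path.Homotopic.Quotient.mk_refl,
        Path.Homotopic.Quotient.refl_trans, Path.Homotopic.Quotient.eq]
      exact ((hsc j).homotopic_of_forall_mem ε ζ hε fun s => (hζ s).2).trans
        ((hsc i).homotopic_of_forall_mem ζ δ (fun s => (hζ s).1) hδ)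
    | succ n ih =>
      intro i j δ ε hδ hε
      obtain ⟨k, hk⟩ := hsub n
      have hsucc : t n ≤ t (n + 1) := htm n.le_succ
      have hk' : ∀ s, γ.subpath (t n) (t (n + 1)) s ∈ c k := by
        intro s
        have : γ.subpath (t n) (t (n + 1)) s ∈ Set.range (γ.subpath (t n) (t (n + 1))) := ⟨s, rfl⟩
        rw [Path.range_subpath_of_le _ _ _ hsucc] at this
        obtain ⟨u, hu, hu'⟩ := this
        exact hu' ▸ hk hu
      obtain ⟨ζ, hζ⟩ := (hpc k j).joinedIn (γ (t (n + 1)))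
        ⟨hk ⟨hsucc, le_rfl⟩, by simpa using hε 0⟩ b ⟨hb k, hb j⟩
      rw [← ih i k δ ((γ.subpath (t n) (t (n + 1))).trans ζ) hδ ?_]
      · have h₁ : Path.Homotopic.Quotient.mk ε = Path.Homotopic.Quotient.mk ζ :=
          Path.Homotopic.Quotient.eq.2
            ((hsc j).homotopic_of_forall_mem ε ζ hε fun s => (hζ s).2)
        have h₂ : Path.Homotopic.Quotient.mk (γ.subpath (t 0) (t (n + 1))) =
            Path.Homotopic.Quotient.mk
              ((γ.subpath (t 0) (t n)).trans (γ.subpath (t n) (t (n + 1)))) :=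
          Path.Homotopic.Quotient.eq.2
            ⟨(Path.Homotopy.subpathTransSubpath γ (t 0) (t n) (t (n + 1))).symm⟩
        simp only [Path.Homotopic.Quotient.mk_trans] at h₂ ⊢
        rw [h₁, h₂, Path.Homotopic.Quotient.trans_assoc]
      · intro s
        have : (γ.subpath (t n) (t (n + 1))).trans ζ s ∈
            Set.range ((γ.subpath (t n) (t (n + 1))).trans ζ) := ⟨s, rfl⟩
        rw [Path.trans_range] at this
        obtain ⟨u, hu⟩ | ⟨u, hu⟩ := this
        · exact hu ▸ hk' u
        · exact hu ▸ (hζ u).1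
  have := key N i j
  rw [hN N le_rfl, ht0, Path.subpath_zero_one] at this
  obtain ⟨f, rfl, rfl⟩ := γ
  exact this δ ε hδ hε

theorem SimplyConnectedSpace.of_isOpen_cover {X ι : Type*} [TopologicalSpace X]
    {c : ι → Set X} (hc : ∀ i, IsOpen (c i)) (hsc : ∀ i, IsSimplyConnected (c i))
    (hpc : ∀ i j, IsPathConnected (c i ∩ c j)) (hcov : ⋃ i, c i = Set.univ) {b : X}
    (hb : ∀ i, b ∈ c i) : SimplyConnectedSpace X := by
  have hjoin : ∀ x : X, ∃ i, JoinedIn (c i) x b := by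
    intro x
    obtain ⟨i, hi⟩ := Set.mem_iUnion.1 (hcov.symm ▸ Set.mem_univ x)
    exact ⟨i, (hsc i).isPathConnected.joinedIn x hi b (hb i)⟩
  refine simply_connected_iff_paths_homotopic'.2 ⟨⟨⟨b⟩, fun x y => ?_⟩, fun {x y} p q => ?_⟩
  · exact (hjoin x).choose_spec.joined.trans (hjoin y).choose_spec.joined.symm
  · obtain ⟨i, δ, hδ⟩ := hjoin x
    obtain ⟨j, ε, hε⟩ := hjoin y
    have h : ∀ p : Path x y, Path.Homotopic.Quotient.mk p =
        (Path.Homotopic.Quotient.mk δ).trans (Path.Homotopic.Quotient.mk ε).symm := by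
      intro p
      rw [← Path.Homotopic.Quotient.mk_trans_eq_of_isOpen_cover hc hsc hpc hcov hb p δ ε hδ hε,
        Path.Homotopic.Quotient.mk_trans, Path.Homotopic.Quotient.trans_assoc,
        Path.Homotopic.Quotient.trans_symm, Path.Homotopic.Quotient.trans_refl]
    exact Path.Homotopic.Quotient.eq.1 ((h p).trans (h q).symm)

/-- The affine quadric surface `x * y + z ^ 2 = 1`. -/
abbrev AffineQuadric : Type := {p : ℂ × ℂ × ℂ // p.1 * p.2.1 + p.2.2 ^ 2 = 1}

namespace AffineQuadric

/-- The complement of the line `y = 0, z = -1`. -/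
def chart : Set AffineQuadric := {p | ¬(p.1.2.1 = 0 ∧ p.1.2.2 = -1)}

theorem isOpen_chart : IsOpen chart := by
  have h : IsClosed {p : AffineQuadric | p.1.2.1 = 0 ∧ p.1.2.2 = -1} :=
    (isClosed_eq (by fun_prop) (by fun_prop)).inter (isClosed_eq (by fun_prop) (by fun_prop))
  exact h.isOpen_compl

theorem normSq_add_normSq_ne_zero {p : AffineQuadric} (hp : p ∈ chart) :
    ((Complex.normSq (1 + p.1.2.2) + Complex.normSq p.1.2.1 : ℝ) : ℂ) ≠ 0 := by
  intro h
  have h' : Complex.normSq (1 + p.1.2.2) + Complex.normSq p.1.2.1 = 0 := by exact_mod_cast h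
  have h₁ := Complex.normSq_nonneg (1 + p.1.2.2)
  have h₂ := Complex.normSq_nonneg p.1.2.1
  have h₃ : 1 + p.1.2.2 = 0 := Complex.normSq_eq_zero.1 (by linarith)
  exact hp ⟨Complex.normSq_eq_zero.1 (by linarith), by linear_combination h₃⟩

/-- The function `x / (1 + z) = (1 - z) / y` on the chart. -/
def slope (p : AffineQuadric) : ℂ :=
  (p.1.1 * star (1 + p.1.2.2) + (1 - p.1.2.2) * star p.1.2.1) /
    ((Complex.normSq (1 + p.1.2.2) + Complex.normSq p.1.2.1 : ℝ) : ℂ)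

theorem slope_mul_y {p : AffineQuadric} (hp : p ∈ chart) : slope p * p.1.2.1 = 1 - p.1.2.2 := by
  rw [slope, div_mul_eq_mul_div, div_eq_iff (normSq_add_normSq_ne_zero hp)]
  push_cast
  rw [Complex.normSq_eq_conj_mul_self, Complex.normSq_eq_conj_mul_self]
  simp only [← starRingEnd_apply]
  linear_combination (starRingEnd ℂ (1 + p.1.2.2)) * p.2

theorem slope_mul_one_add {p : AffineQuadric} (hp : p ∈ chart) :
    slope p * (1 + p.1.2.2) = p.1.1 := by
  rw [slope, div_mul_eq_mul_div, div_eq_iff (normSq_add_normSq_ne_zero hp)]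
  push_cast
  rw [Complex.normSq_eq_conj_mul_self, Complex.normSq_eq_conj_mul_self]
  simp only [← starRingEnd_apply]
  linear_combination -(starRingEnd ℂ p.1.2.1) * p.2

/-- The chart is an affine plane. -/
def chartHomeomorph : chart ≃ₜ ℂ × ℂ where
  toFun p := (slope p, p.1.1.2.1)
  invFun q := ⟨⟨(q.1 * (2 - q.1 * q.2), q.2, 1 - q.1 * q.2), by ring⟩, by
    rintro ⟨h₁, h₂⟩
    simp only at h₁ h₂
    rw [h₁] at h₂
    norm_num at h₂⟩
  left_inv p := by
    have h₁ := slope_mul_y p.2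
    have h₂ := slope_mul_one_add p.2
    refine Subtype.ext (Subtype.ext (Prod.ext ?_ (Prod.ext rfl ?_)))
    · simp only
      linear_combination h₂ - slope p * h₁
    · simp only
      linear_combination -h₁
  right_inv q := by
    refine Prod.ext ?_ rfl
    simp only
    rw [slope, div_eq_iff (normSq_add_normSq_ne_zero (by
      rintro ⟨h₁, h₂⟩
      simp only at h₁ h₂
      rw [h₁] at h₂
      norm_num at h₂))]
    push_cast
    rw [Complex.normSq_eq_conj_mul_self, Complex.normSq_eq_conj_mul_self]
    simp only [← starRingEnd_apply]
    ring
  continuous_toFun := by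
    refine Continuous.prodMk (Continuous.div ?_ ?_ fun p => normSq_add_normSq_ne_zero p.2) ?_
    · fun_prop
    · exact Complex.continuous_ofReal.comp ((Complex.continuous_normSq.comp (by fun_prop)).add
        (Complex.continuous_normSq.comp (by fun_prop)))
    · fun_prop
  continuous_invFun := by fun_prop

theorem isSimplyConnected_chart : IsSimplyConnected chart :=
  chartHomeomorph.toHomotopyEquiv.simplyConnectedSpace

/-- The involution `z ↦ -z`. -/
def negZ : AffineQuadric ≃ₜ AffineQuadric where
  toFun p := ⟨(p.1.1, p.1.2.1, -p.1.2.2), by simpa using p.2⟩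
  invFun p := ⟨(p.1.1, p.1.2.1, -p.1.2.2), by simpa using p.2⟩
  left_inv p := by simp
  right_inv p := by simp
  continuous_toFun := by fun_prop
  continuous_invFun := by fun_prop

theorem mem_negZ_preimage_chart {p : AffineQuadric} :
    p ∈ negZ ⁻¹' chart ↔ ¬(p.1.2.1 = 0 ∧ p.1.2.2 = 1) := by
  simp [chart, negZ]

theorem chart_inter : chart ∩ negZ ⁻¹' chart = {p | p.1.2.1 ≠ 0} := by
  ext p
  rw [Set.mem_inter_iff, mem_negZ_preimage_chart]
  simp only [chart, Set.mem_ofPred_eq]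
  constructor
  · rintro ⟨h₁, h₂⟩ h
    have : p.1.2.2 ^ 2 = 1 := by simpa [h] using p.2
    obtain h' | h' := sq_eq_sq_iff_eq_or_eq_neg.1 (this.trans (one_pow 2).symm)
    all_goals tauto
  · tauto

theorem isPathConnected_chart_inter : IsPathConnected (chart ∩ negZ ⁻¹' chart) := by
  have h₁ : IsPathConnected ({0}ᶜ ×ˢ Set.univ : Set (ℂ × ℂ)) :=
    (isPathConnected_compl_singleton_of_one_lt_rank (by simp) 0).prod isPathConnected_univ
  have := isPathConnected_iff_pathConnectedSpace.1 h₁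
  let f : ({0}ᶜ ×ˢ Set.univ : Set (ℂ × ℂ)) → AffineQuadric := fun q =>
    ⟨((1 - q.1.2 ^ 2) / q.1.1, q.1.1, q.1.2), by
      have : q.1.1 ≠ 0 := q.2.1
      field_simp
      ring⟩
  have hf : Continuous f := by
    refine Continuous.subtype_mk (Continuous.prodMk (Continuous.div (by fun_prop) (by fun_prop)
      fun q => q.2.1) (by fun_prop)) _
  convert isPathConnected_range hf
  rw [chart_inter]
  ext p
  constructor
  · intro hp
    have hp' : p.1.2.1 ≠ 0 := hp
    refine ⟨⟨p.1.2, hp, trivial⟩, Subtype.ext (Prod.ext ?_ rfl)⟩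
    simp only [f]
    rw [div_eq_iff hp']
    linear_combination -p.2
  · rintro ⟨q, rfl⟩
    exact q.2.1

instance : SimplyConnectedSpace AffineQuadric := by
  refine SimplyConnectedSpace.of_isOpen_cover (c := fun i : Bool => cond i chart (negZ ⁻¹' chart))
    (b := ⟨(1, 1, 0), by simp⟩) ?_ ?_ ?_ ?_ ?_
  · rintro (_ | _)
    exacts [isOpen_chart.preimage negZ.continuous, isOpen_chart]
  · rintro (_ | _)
    exacts [negZ.isSimplyConnected_preimage.2 isSimplyConnected_chart, isSimplyConnected_chart]
  · rintro (_ | _) (_ | _)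
    · simpa using (negZ.isSimplyConnected_preimage.2 isSimplyConnected_chart).isPathConnected
    · simpa [Set.inter_comm] using isPathConnected_chart_inter
    · simpa using isPathConnected_chart_inter
    · simpa using isSimplyConnected_chart.isPathConnected
  · refine Set.eq_univ_of_forall fun p => Set.mem_iUnion.2 ?_
    by_cases h : p ∈ chart
    · exact ⟨true, h⟩
    · refine ⟨false, mem_negZ_preimage_chart.2 fun h' => h fun h'' => ?_⟩
      have := h'.2.symm.trans h''.2
      norm_num at this
  · rintro (_ | _)
    · exact mem_negZ_preimage_chart.2 (by simp)
    · simp [chart]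

end AffineQuadric

namespace MvPolynomial

theorem pderiv_pderiv_comm {σ R : Type*} [CommRing R] (i j : σ) (p : MvPolynomial σ R) :
    pderiv i (pderiv j p) = pderiv j (pderiv i p) := by
  classical
  have h : ⁅(pderiv i : Derivation R (MvPolynomial σ R) _), pderiv j⁆ = 0 :=
    derivation_ext fun k => by
      rw [Derivation.commutator_apply]
      by_cases hi : i = k <;> by_cases hj : j = k <;> simp [pderiv_X, hi, hj]
  have := congrArg (fun D => D p) h
  rw [Derivation.commutator_apply] at this
  exact sub_eq_zero.1 this

/-- The matrix of the bilinear form whose quadratic form is `P`, when `P` is homogeneous of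
degree `2`. -/
def halfHessian {σ : Type*} (P : MvPolynomial σ ℂ) : Matrix σ σ ℂ :=
  fun i j => 2⁻¹ * coeff 0 (pderiv j (pderiv i P))

theorem halfHessian_comm {σ : Type*} (P : MvPolynomial σ ℂ) (i j : σ) :
    P.halfHessian i j = P.halfHessian j i := by
  rw [halfHessian, halfHessian, pderiv_pderiv_comm]

theorem IsHomogeneous.eval_pderiv_eq {σ : Type*} [Fintype σ] {P : MvPolynomial σ ℂ}
    (hP : P.IsHomogeneous 2) (v : σ → ℂ) (i : σ) :
    eval v (pderiv i P) = 2 * ∑ j, P.halfHessian i j * v j := by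
  have h := congrArg (eval v) (hP.pderiv (i := i)).sum_X_mul_pderiv
  simp only [Nat.add_one_sub_one, one_smul, map_sum, map_mul, eval_X] at h
  rw [← h, Finset.mul_sum]
  refine Finset.sum_congr rfl fun j _ => ?_
  have h0 : (pderiv j (pderiv i P)).IsHomogeneous 0 := (hP.pderiv (i := i)).pderiv
  rw [← totalDegree_zero_iff_isHomogeneous, totalDegree_eq_zero_iff_eq_C] at h0
  rw [h0, eval_C, halfHessian]
  ring

theorem IsHomogeneous.eval_eq_sum {σ : Type*} [Fintype σ] {P : MvPolynomial σ ℂ}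
    (hP : P.IsHomogeneous 2) (v : σ → ℂ) : eval v P = ∑ i, ∑ j, v i * P.halfHessian i j * v j := by
  have h := congrArg (eval v) hP.sum_X_mul_pderiv
  simp only [map_sum, map_mul, eval_X, hP.eval_pderiv_eq, nsmul_eq_mul, Nat.cast_ofNat,
    map_ofNat] at h
  refine mul_left_cancel₀ (two_ne_zero (α := ℂ)) (h.symm.trans ?_)
  simp only [Finset.mul_sum]
  exact Finset.sum_congr rfl fun i _ => Finset.sum_congr rfl fun j _ => by ring

theorem IsHomogeneous.exists_linearEquiv_eval_eq_sum_sq {σ : Type*} [Fintype σ]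
    {P : MvPolynomial σ ℂ} (hP : P.IsHomogeneous 2)
    (hgrad : ∀ v : σ → ℂ, v ≠ 0 → (fun i => eval v (pderiv i P)) ≠ 0) :
    ∃ T : (σ → ℂ) ≃ₗ[ℂ] (Fin (Fintype.card σ) → ℂ), ∀ v, eval v P = ∑ i, T v i ^ 2 := by
  classical
  set B : LinearMap.BilinMap ℂ (σ → ℂ) ℂ := Matrix.toLinearMap₂' ℂ P.halfHessian with hB
  have hBsymm : B.IsSymm := ⟨fun v w => by
    simp only [hB, Matrix.toLinearMap₂'_apply, RingHom.id_apply, smul_eq_mul]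
    rw [Finset.sum_comm]
    exact Finset.sum_congr rfl fun i _ => Finset.sum_congr rfl fun j _ => by
      rw [P.halfHessian_comm]; ring⟩
  have hassoc : QuadraticMap.associated (R := ℂ) B.toQuadraticMap = B :=
    QuadraticMap.associated_left_inverse ℂ hBsymm.eq
  have hsep : (QuadraticMap.associated (R := ℂ) B.toQuadraticMap).SeparatingLeft := by
    rw [hassoc]
    intro v hv
    by_contra hne
    refine hgrad v hne (_root_.funext fun i => ?_)
    have := hv (Pi.single i 1)
    rw [hP.eval_pderiv_eq]
    simp only [hB, Matrix.toLinearMap₂'_apply, Pi.single_apply, smul_eq_mul, mul_ite, ite_mul,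
      one_mul, zero_mul, mul_zero, Finset.sum_ite_eq', Finset.mem_univ, if_true] at this
    refine mul_eq_zero_of_right 2 (Eq.trans ?_ this)
    exact Finset.sum_congr rfl fun j _ => by rw [P.halfHessian_comm i j, mul_comm]
  have e := QuadraticForm.equivalent_weightedSumSquares_of_isAlgClosed B.toQuadraticMap hsep
  rw [Module.finrank_fintype_fun_eq_card] at e
  obtain ⟨e⟩ := e
  refine ⟨e.toLinearEquiv, fun v => ?_⟩
  have := e.map_app v
  rw [hP.eval_eq_sum]
  simp only [QuadraticMap.weightedSumSquares_apply, LinearMap.BilinMap.toQuadraticMap_apply, hB,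
    Matrix.toLinearMap₂'_apply] at this
  simp only [pow_two]
  simpa [mul_comm, mul_assoc, mul_left_comm] using this.symm

theorem IsHomogeneous.eval_smul_of_two {σ : Type*} [Fintype σ] {P : MvPolynomial σ ℂ}
    (hP : P.IsHomogeneous 2) (a : ℂ) (v : σ → ℂ) : eval (a • v) P = a ^ 2 * eval v P := by
  simp only [hP.eval_eq_sum, Pi.smul_apply, smul_eq_mul, Finset.mul_sum]
  exact Finset.sum_congr rfl fun i _ => Finset.sum_congr rfl fun j _ => by ring

/-- The affine hypersurface `P = 1`. -/
abbrev UnitLevel (P : MvPolynomial (Fin 3) ℂ) : Type := {v : Fin 3 → ℂ // eval v P = 1}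

namespace UnitLevel

open Topology

variable {P : MvPolynomial (Fin 3) ℂ} (hP : P.IsHomogeneous 2)
include hP

theorem nonempty_homeomorph_affineQuadric
    (hgrad : ∀ v : Fin 3 → ℂ, v ≠ 0 → gradP P v ≠ 0) :
    Nonempty (AffineQuadric ≃ₜ UnitLevel P) := by
  obtain ⟨T, hT⟩ : ∃ T : (Fin 3 → ℂ) ≃ₗ[ℂ] (Fin 3 → ℂ), ∀ v, eval v P = ∑ i, T v i ^ 2 := by
    have := hP.exists_linearEquiv_eval_eq_sum_sq hgrad
    rwa [Fintype.card_fin] at this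
  have hTc : Continuous T := T.toLinearMap.continuous_of_finiteDimensional
  have hTc' : Continuous T.symm := T.symm.toLinearMap.continuous_of_finiteDimensional
  have hI := Complex.I_sq
  refine ⟨{
    toFun p := ⟨T.symm ![(p.1.1 + p.1.2.1) / 2, -Complex.I * (p.1.1 - p.1.2.1) / 2, p.1.2.2], ?_⟩
    invFun v := ⟨(T v.1 0 + Complex.I * T v.1 1, T v.1 0 - Complex.I * T v.1 1, T v.1 2), ?_⟩
    left_inv p := ?_
    right_inv v := ?_
    continuous_toFun := ?_
    continuous_invFun := ?_ }⟩
  · rw [hT, T.apply_symm_apply, Fin.sum_univ_three]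
    simp only [Matrix.cons_val]
    linear_combination p.2 + (p.1.1 - p.1.2.1) ^ 2 / 4 * hI
  · have hv := v.2
    rw [hT, Fin.sum_univ_three] at hv
    linear_combination hv - (T v.1 1) ^ 2 * hI
  · refine Subtype.ext (Prod.ext ?_ (Prod.ext ?_ ?_)) <;>
      simp only [T.apply_symm_apply, Matrix.cons_val]
    · linear_combination -(p.1.1 - p.1.2.1) / 2 * hI
    · linear_combination (p.1.1 - p.1.2.1) / 2 * hI
  · refine Subtype.ext (T.injective ?_)
    rw [T.apply_symm_apply]
    ext i
    fin_cases i
    · simp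
    · simp
      linear_combination -(T v.1 1) * hI
    · simp
  · refine Continuous.subtype_mk (hTc'.comp ?_) _
    refine continuous_pi fun i => ?_
    fin_cases i <;> simp <;> fun_prop
  · have h : ∀ i, Continuous fun v : UnitLevel P => T v.1 i := fun i =>
      (continuous_apply i).comp (hTc.comp continuous_subtype_val)
    have h0 := h 0
    have h1 := h 1
    have h2 := h 2
    fun_prop

/-- The action of `{1, -1}` on `P = 1`. -/
abbrev mulAction : MulAction ℤˣ (UnitLevel P) where
  smul u v := ⟨((u : ℤ) : ℂ) • v.1, by
    rw [hP.eval_smul_of_two, v.2, ← Int.cast_pow, ← Units.val_pow_eq_pow_val, Int.units_sq]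
    simp⟩
  one_smul v := Subtype.ext (by
    change (((1 : ℤˣ) : ℤ) : ℂ) • v.1 = v.1
    simp)
  mul_smul u w v := Subtype.ext (by
    change (((u * w : ℤˣ) : ℤ) : ℂ) • v.1 = ((u : ℤ) : ℂ) • ((w : ℤ) : ℂ) • v.1
    simp [mul_smul])

theorem ne_zero (v : UnitLevel P) : v.1 ≠ 0 := by
  intro h
  have := v.2
  rw [h, ← zero_smul ℂ (0 : Fin 3 → ℂ), hP.eval_smul_of_two] at this
  simp at this

theorem mk_mem_zeroLocusP2_iff {v : Fin 3 → ℂ} (hv : v ≠ 0) :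
    Projectivization.mk ℂ v hv ∈ zeroLocusP2 P ↔ eval v P = 0 := by
  obtain ⟨a, ha⟩ := Projectivization.exists_smul_eq_mk_rep ℂ v hv
  change eval (Projectivization.mk ℂ v hv).rep P = 0 ↔ _
  rw [← ha, Units.smul_def, hP.eval_smul_of_two]
  simp

/-- The projection from `P = 1` to the complement of the curve `P = 0`. -/
def proj (v : UnitLevel P) : ↥(zeroLocusP2 P)ᶜ :=
  ⟨Projectivization.mk ℂ v.1 (ne_zero hP v), by
    rw [Set.mem_compl_iff, mk_mem_zeroLocusP2_iff hP, v.2]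
    exact one_ne_zero⟩

theorem proj_eq_proj_iff {v w : UnitLevel P} :
    letI := mulAction hP
    proj hP v = proj hP w ↔ v ∈ MulAction.orbit ℤˣ w := by
  let := mulAction hP
  rw [proj, proj, Subtype.mk.injEq, Projectivization.mk_eq_mk_iff']
  constructor
  · rintro ⟨a, ha⟩
    have h := hP.eval_smul_of_two a w.1
    rw [ha, v.2, w.2, mul_one] at h
    obtain rfl | rfl := sq_eq_sq_iff_eq_or_eq_neg.1 (h.symm.trans (one_pow 2).symm)
    · exact ⟨1, Subtype.ext (by rw [← ha]; change (((1 : ℤˣ) : ℤ) : ℂ) • w.1 = _; simp)⟩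
    · exact ⟨-1, Subtype.ext (by rw [← ha]; change (((-1 : ℤˣ) : ℤ) : ℂ) • w.1 = _; simp)⟩
  · rintro ⟨u, rfl⟩
    exact ⟨((u : ℤ) : ℂ), rfl⟩

omit hP in
theorem isQuotientMap_mk : IsQuotientMap fun v : {v : Fin 3 → ℂ // v ≠ 0} =>
    (Projectivization.mk ℂ v.1 v.2 : P2) :=
  @isQuotientMap_quot_mk _ _ (projectivizationSetoid ℂ (Fin 3 → ℂ)).r

theorem isOpen_compl_zeroLocusP2 : IsOpen (zeroLocusP2 P)ᶜ := by
  rw [← isQuotientMap_mk.isOpen_preimage]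
  have : (fun v : {v : Fin 3 → ℂ // v ≠ 0} => (Projectivization.mk ℂ v.1 v.2 : P2)) ⁻¹'
      (zeroLocusP2 P)ᶜ = {v | eval v.1 P ≠ 0} := by
    ext v
    exact not_congr (mk_mem_zeroLocusP2_iff hP v.2)
  rw [this]
  exact isOpen_ne_fun (P.continuous_eval.comp continuous_subtype_val) continuous_const

theorem isQuotientMap_proj : IsQuotientMap (proj hP) := by
  set π := fun v : {v : Fin 3 → ℂ // v ≠ 0} => (Projectivization.mk ℂ v.1 v.2 : P2) with hπ
  have hπ' := isQuotientMap_mk.restrictPreimage_isOpen (isOpen_compl_zeroLocusP2 hP)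
  have hW : ∀ w : π ⁻¹' (zeroLocusP2 P)ᶜ, eval w.1.1 P ≠ 0 := fun w =>
    mt (mk_mem_zeroLocusP2_iff hP w.1.2).2 w.2
  have hcont : Continuous (proj hP) := by
    refine Continuous.subtype_mk ?_ _
    exact isQuotientMap_mk.continuous.comp
      (Continuous.subtype_mk continuous_subtype_val fun v => ne_zero hP v)
  -- a section of `proj` through the image of `w₀`, continuous there
  have key : ∀ w₀ : π ⁻¹' (zeroLocusP2 P)ᶜ, ∃ g : π ⁻¹' (zeroLocusP2 P)ᶜ → UnitLevel P,
      ContinuousAt g w₀ ∧ ∀ w, proj hP (g w) = (zeroLocusP2 P)ᶜ.restrictPreimage π w := by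
    intro w₀
    obtain ⟨s₀, hs₀⟩ := IsAlgClosed.exists_pow_nat_eq (eval w₀.1.1 P) two_pos
    let r : π ⁻¹' (zeroLocusP2 P)ᶜ → ℂ := fun w =>
      s₀ * (eval w.1.1 P / eval w₀.1.1 P) ^ ((2 : ℕ) : ℂ)⁻¹
    have hr : ∀ w, r w ^ 2 = eval w.1.1 P := fun w => by
      simp only [r]
      rw [mul_pow, Complex.cpow_nat_inv_pow _ two_ne_zero, hs₀, mul_div_cancel₀ _ (hW w₀)]
    have hr0 : ∀ w, r w ≠ 0 := fun w h => hW w (by rw [← hr, h, zero_pow two_ne_zero])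
    have hcr : ContinuousAt r w₀ := by
      refine continuousAt_const.mul (ContinuousAt.cpow ?_ continuousAt_const ?_)
      · have : Continuous fun w : π ⁻¹' (zeroLocusP2 P)ᶜ => eval w.1.1 P :=
          P.continuous_eval.comp (by fun_prop)
        exact (this.div_const _).continuousAt
      · rw [div_self (hW w₀)]
        exact Complex.one_mem_slitPlane
    refine ⟨fun w => ⟨(r w)⁻¹ • w.1.1, ?_⟩, ?_, fun w => Subtype.ext ?_⟩
    · rw [hP.eval_smul_of_two, inv_pow, hr, inv_mul_cancel₀ (hW w)]
    · refine IsEmbedding.subtypeVal.continuousAt_iff.2 ?_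
      exact (hcr.inv₀ (hr0 w₀)).smul (by fun_prop)
    · exact (Projectivization.mk_eq_mk_iff' ..).2 ⟨(r w)⁻¹, rfl⟩
  refine ⟨isCoinducing_iff.2 fun s => ⟨fun hs => ?_, fun hs => hs.preimage hcont⟩, fun x => ?_⟩
  · rw [← hπ'.isOpen_preimage, isOpen_iff_mem_nhds]
    intro w hw
    obtain ⟨g, hgc, hg⟩ := key w
    filter_upwards [hgc.preimage_mem_nhds (hs.mem_nhds (show proj hP (g w) ∈ s from hg w ▸ hw))]
      with w' hw'
    exact (hg w' ▸ hw' : (zeroLocusP2 P)ᶜ.restrictPreimage π w' ∈ s)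
  · obtain ⟨w, rfl⟩ := hπ'.surjective x
    obtain ⟨g, -, hg⟩ := key w
    exact ⟨g w, hg w⟩

theorem isQuotientCoveringMap_proj :
    letI := mulAction hP
    IsQuotientCoveringMap (proj hP) ℤˣ := by
  let := mulAction hP
  have : ContinuousConstSMul ℤˣ (UnitLevel P) := ⟨fun u =>
    Continuous.subtype_mk (continuous_subtype_val.const_smul ((u : ℤ) : ℂ)) _⟩
  have hclosed : IsClosed {v : Fin 3 → ℂ | eval v P = 1} :=
    isClosed_eq P.continuous_eval continuous_const
  have : LocallyCompactSpace (UnitLevel P) :=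
    hclosed.isClosedEmbedding_subtypeVal.locallyCompactSpace
  have : IsCancelSMul ℤˣ (UnitLevel P) := isCancelSMul_iff_eq_one_of_smul_eq.2 fun u v h => by
    obtain rfl | rfl := Int.units_eq_one_or u
    · rfl
    · have h' : (((-1 : ℤˣ) : ℤ) : ℂ) • v.1 = v.1 := congrArg Subtype.val h
      exact absurd (self_eq_neg.1 (by simpa using h'.symm)) (ne_zero hP v)
  exact (isQuotientMap_proj hP).isQuotientCoveringMap_of_properlyDiscontinuousSMul
    (proj_eq_proj_iff hP)

end UnitLevel

end MvPolynomial

/-- **Theorem.** The fundamental group of the complement of a smooth conic in `ℙ²` is `ℤ/2ℤ`. -/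
theorem fundamental_group_smooth_conic_complement (Q : Set P2) (hQ : IsSmoothConic Q)
    (x : ↥Qᶜ) :
    Nonempty (FundamentalGroup (↥Qᶜ) x ≃* Multiplicative (ZMod 2)) := by
  obtain ⟨P, hP, hgrad, rfl⟩ := hQ
  let := MvPolynomial.UnitLevel.mulAction hP
  obtain ⟨e⟩ := MvPolynomial.UnitLevel.nonempty_homeomorph_affineQuadric hP hgrad
  have : SimplyConnectedSpace (MvPolynomial.UnitLevel P) :=
    e.symm.toHomotopyEquiv.simplyConnectedSpace
  have hcov := MvPolynomial.UnitLevel.isQuotientCoveringMap_proj hP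
  obtain ⟨v, hv⟩ := hcov.surjective x
  have hcyc : IsCyclic ℤˣ := inferInstance
  exact ⟨(hcov.fundamentalGroupEquiv ⟨v, hv⟩).trans (MulOpposite.opMulEquiv.symm.trans
    (mulEquivOfCyclicCardEq (by simp)))⟩
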